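/- arXiv:1707.08689 — 2 statements merged into one kernel-verified Lean document; each statement's English description precedes it below -/
import Mathlib

section
/- Let G_S and G_T be nonzero rational functions in RatFunc ℝ (transfer functions of the discrete-time source and target systems in the forward shift variable z). Assume G_T is BIBO stable (every complex root of G_T.denom, mapped into ℂ, has absolute value strictly less than 1) and G_S is minimum-phase (every complex root of G_S.denom and every complex root of G_S.num has absolute value strictly less than 1). Then there exists a rational function G_α ∈ RatFunc ℝ that is causal (G_α.intDegree ≤ 0), BIBO stable (every complex root of G_α.denom has absolute value strictly less than 1), and achieves perfect transfer learning (G_α * G_S = G_T), if and only if G_T.intDegree ≤ G_S.intDegree (equivalently, the relative degree of G_S is at most the relative degree of G_T). -/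
/-- The denominator of a quotient divides the product of the denominator of the dividend and the
numerator of the divisor. -/
theorem RatFunc.denom_div_dvd_denom_mul_num {K : Type*} [Field K] (x : RatFunc K) {y : RatFunc K}
    (hy : y ≠ 0) : (x / y).denom ∣ x.denom * y.num := by
  rw [div_eq_mul_inv]
  exact (RatFunc.denom_mul_dvd x y⁻¹).trans (mul_dvd_mul_left _ (RatFunc.denom_inv_dvd hy))

/-- Theorem 2 (discrete time): for BIBO-stable SISO LTI systems with
minimum-phase source, a causal, BIBO-stable perfect transfer learning map
exists iff the relative degree of the source is at most that of the target
(equivalently, `G_T.intDegree ≤ G_S.intDegree`). -/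
theorem exists_causal_stable_perfect_TL_map_iff_discrete
    (G_S G_T : RatFunc ℝ) (hS : G_S ≠ 0) (hT : G_T ≠ 0)
    (hT_stable : ∀ z : ℂ, (G_T.denom.map (algebraMap ℝ ℂ)).IsRoot z → ‖z‖ < 1)
    (hS_den_stable : ∀ z : ℂ, (G_S.denom.map (algebraMap ℝ ℂ)).IsRoot z → ‖z‖ < 1)
    (hS_num_stable : ∀ z : ℂ, (G_S.num.map (algebraMap ℝ ℂ)).IsRoot z → ‖z‖ < 1) :
    (∃ G_α : RatFunc ℝ,
        G_α.intDegree ≤ 0 ∧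
        (∀ z : ℂ, (G_α.denom.map (algebraMap ℝ ℂ)).IsRoot z → ‖z‖ < 1) ∧
        G_α * G_S = G_T) ↔
      G_T.intDegree ≤ G_S.intDegree := by
  constructor
  · rintro ⟨G, hG, -, rfl⟩
    rw [RatFunc.intDegree_mul (left_ne_zero_of_mul hT) hS]
    linarith
  · intro h
    refine ⟨G_T / G_S, ?_, fun z hz => ?_, div_mul_cancel₀ _ hS⟩
    · rw [RatFunc.intDegree_div hT hS]
      linarith
    · have hroot := hz.dvd (Polynomial.map_dvd (algebraMap ℝ ℂ)
        (RatFunc.denom_div_dvd_denom_mul_num G_T hS))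
      rw [Polynomial.map_mul, Polynomial.root_mul] at hroot
      exact hroot.elim (hT_stable z) (hS_num_stable z)
end

section
/- Let F and G be rational functions in RatFunc ℝ with G ≠ 0. If every complex root of F.denom (mapped into ℂ) has absolute value strictly less than 1 and every complex root of G.num (mapped into ℂ) has absolute value strictly less than 1, then every complex root of (F * G⁻¹).denom (mapped into ℂ) has absolute value strictly less than 1. -/
/-- Discrete-time stability of the optimal transfer map: if all complex
roots of `F.denom` and of `G.num` lie strictly inside the unit circle, then
so do all complex roots of `(F * G⁻¹).denom`. -/
theorem denom_mul_inv_roots_abs_lt_one (F G : RatFunc ℝ) (hG : G ≠ 0)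
    (hF_den : ∀ z : ℂ, (F.denom.map (algebraMap ℝ ℂ)).IsRoot z → ‖z‖ < 1)
    (hG_num : ∀ z : ℂ, (G.num.map (algebraMap ℝ ℂ)).IsRoot z → ‖z‖ < 1) :
    ∀ z : ℂ, ((F * G⁻¹).denom.map (algebraMap ℝ ℂ)).IsRoot z → ‖z‖ < 1 := by
  intro z hz
  have hdvd : (F * G⁻¹).denom ∣ F.denom * G.num :=
    (RatFunc.denom_mul_dvd F G⁻¹).trans (mul_dvd_mul_left _ (RatFunc.denom_inv_dvd hG))
  have hroot := hz.dvd (Polynomial.map_dvd (algebraMap ℝ ℂ) hdvd)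
  rw [Polynomial.map_mul, Polynomial.root_mul] at hroot
  exact hroot.elim (hF_den z) (hG_num z)
end
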